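/- arXiv:1808.01663 — 7 statements merged into one kernel-verified Lean document; each statement's English description precedes it below -/
import Mathlib

section
/- Let (X,d) be a premetric space, F, F' Cauchy families on X, and p a nonnegative rational. Then d(F,F') ≤ p if and only if d(F,F') ≤ q for every rational q > p. -/
/-- A premetric on a set `X` (Richman): a relation `le x y q`, read "d(x,y) ≤ q",
between pairs of points and nonnegative rationals. -/
structure Premetric (X : Type*) where
  le : X → X → ℚ≥0 → Prop
  refl_iff : ∀ x y : X, le x y 0 ↔ x = y
  symm : ∀ (x y : X) (q : ℚ≥0), le x y q → le y x q
  triangle : ∀ (x y z : X) (p q : ℚ≥0), le x z p → le z y q → le x y (p + q)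
  upper : ∀ (x y : X) (p : ℚ≥0), le x y p ↔ ∀ q : ℚ≥0, p < q → le x y q

/-- A pseudo-premetric on a set `X`: conditions (2),(3),(4) of a premetric
together with `d(x,x) ≤ 0` for all `x`. -/
structure PseudoPremetric (X : Type*) where
  le : X → X → ℚ≥0 → Prop
  refl : ∀ x : X, le x x 0
  symm : ∀ (x y : X) (q : ℚ≥0), le x y q → le y x q
  triangle : ∀ (x y z : X) (p q : ℚ≥0), le x z p → le z y q → le x y (p + q)
  upper : ∀ (x y : X) (p : ℚ≥0), le x y p ↔ ∀ q : ℚ≥0, p < q → le x y q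

namespace Premetric

variable {X : Type*} (d : Premetric X)

theorem refl (x : X) : d.le x x 0 := (d.refl_iff x x).2 rfl

theorem mono {x y : X} {p q : ℚ≥0} (h : d.le x y p) (hpq : p ≤ q) : d.le x y q := by
  rcases eq_or_lt_of_le hpq with rfl | hlt
  · exact h
  · exact (d.upper x y p).1 h q hlt

/-- `diam A ≤ q` : any two points of `A` are at distance at most `q`. -/
def diamLE (A : Set X) (q : ℚ≥0) : Prop := ∀ x ∈ A, ∀ y ∈ A, d.le x y q

theorem diamLE_mono {A : Set X} {p q : ℚ≥0} (h : d.diamLE A p) (hpq : p ≤ q) :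
    d.diamLE A q := fun x hx y hy => d.mono (h x hx y hy) hpq

/-- A Cauchy family on a premetric space: a collection of subsets, any two of which
meet, containing sets of arbitrarily small diameter. -/
def IsCauchyFamily (F : Set (Set X)) : Prop :=
  (∀ S ∈ F, ∀ T ∈ F, (S ∩ T).Nonempty) ∧
  (∀ ε : ℚ≥0, 0 < ε → ∃ S ∈ F, d.diamLE S ε)

/-- The pseudo-premetric `d(F,F') ≤ q` between families of subsets of `X`. -/
def famLE (F F' : Set (Set X)) (q : ℚ≥0) : Prop :=
  ∀ ε : ℚ≥0, 0 < ε → ∃ S ∈ F, ∃ T ∈ F',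
    d.diamLE S ε ∧ d.diamLE T ε ∧ d.diamLE (S ∪ T) (q + ε)

theorem isCauchyFamily_singleton (x : X) :
    d.IsCauchyFamily {({x} : Set X)} := by
  constructor
  · intro S hS T hT
    rw [Set.mem_singleton_iff] at hS hT
    subst hS; subst hT
    exact ⟨x, by simp⟩
  · intro ε hε
    refine ⟨{x}, rfl, ?_⟩
    intro a ha b hb
    rw [Set.mem_singleton_iff] at ha hb
    rw [ha, hb]
    exact d.mono (d.refl x) zero_le

theorem famLE_self {F : Set (Set X)} (hF : d.IsCauchyFamily F) (q : ℚ≥0) :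
    d.famLE F F q := by
  intro ε hε
  obtain ⟨S, hS, hdiam⟩ := hF.2 ε hε
  refine ⟨S, hS, S, hS, hdiam, hdiam, ?_⟩
  rw [Set.union_self]
  exact d.diamLE_mono hdiam (le_add_of_nonneg_left zero_le)

theorem famLE_symm {F G : Set (Set X)} {q : ℚ≥0} (h : d.famLE F G q) :
    d.famLE G F q := by
  intro ε hε
  obtain ⟨S, hS, T, hT, h1, h2, h3⟩ := h ε hε
  exact ⟨T, hT, S, hS, h2, h1, by rwa [Set.union_comm]⟩

theorem famLE_mono {F G : Set (Set X)} {p q : ℚ≥0} (h : d.famLE F G p) (hpq : p ≤ q) :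
    d.famLE F G q := by
  intro ε hε
  obtain ⟨S, hS, T, hT, h1, h2, h3⟩ := h ε hε
  exact ⟨S, hS, T, hT, h1, h2, d.diamLE_mono h3 (add_le_add_left hpq ε)⟩

theorem famLE_triangle {F G H : Set (Set X)} {p q : ℚ≥0} (hG : d.IsCauchyFamily G)
    (h1 : d.famLE F G p) (h2 : d.famLE G H q) : d.famLE F H (p + q) := by
  intro ε hε
  have h2pos : (0:ℚ≥0) < 2 := by norm_num
  have hε2 : 0 < ε / 2 := div_pos hε h2pos
  have hhalves : ε / 2 + ε / 2 = ε := by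
    rw [← add_div, ← two_mul, mul_div_cancel_left₀]
    norm_num
  have hhalf : ε / 2 ≤ ε := by
    calc ε / 2 ≤ ε / 2 + ε / 2 := le_add_of_nonneg_right zero_le
    _ = ε := hhalves
  obtain ⟨S, hS, T, hT, hdS, hdT, hST⟩ := h1 (ε/2) hε2
  obtain ⟨T', hT', U, hU, hdT', hdU, hTU⟩ := h2 (ε/2) hε2
  obtain ⟨t, htT, htT'⟩ := hG.1 T hT T' hT'
  have key : ∀ x ∈ S, ∀ y ∈ U, d.le x y (p + q + ε) := by
    intro x hx y hy
    have hxt : d.le x t (p + ε/2) := hST x (Or.inl hx) t (Or.inr htT)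
    have hty : d.le t y (q + ε/2) := hTU t (Or.inl htT') y (Or.inr hy)
    have htr := d.triangle x y t _ _ hxt hty
    have heq : (p + ε/2) + (q + ε/2) = p + q + ε := by
      rw [add_add_add_comm, hhalves]
    rwa [heq] at htr
  refine ⟨S, hS, U, hU, d.diamLE_mono hdS hhalf, d.diamLE_mono hdU hhalf, ?_⟩
  rintro x (hx | hx) y (hy | hy)
  · exact d.mono (hdS x hx y hy) (hhalf.trans (le_add_of_nonneg_left zero_le))
  · exact key x hx y hy
  · exact d.symm _ _ _ (key y hy x hx)
  · exact d.mono (hdU x hx y hy) (hhalf.trans (le_add_of_nonneg_left zero_le))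

theorem famLE_upper {F G : Set (Set X)} (p : ℚ≥0) :
    d.famLE F G p ↔ ∀ q : ℚ≥0, p < q → d.famLE F G q := by
  constructor
  · intro h q hpq
    exact d.famLE_mono h hpq.le
  · intro h ε hε
    have h2pos : (0:ℚ≥0) < 2 := by norm_num
    have hε2 : 0 < ε / 2 := div_pos hε h2pos
    have hhalves : ε / 2 + ε / 2 = ε := by
      rw [← add_div, ← two_mul, mul_div_cancel_left₀]
      norm_num
    have hhalf : ε / 2 ≤ ε := by
      calc ε / 2 ≤ ε / 2 + ε / 2 := le_add_of_nonneg_right zero_le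
      _ = ε := hhalves
    obtain ⟨S, hS, T, hT, h1, h2, h3⟩ :=
      h (p + ε/2) (lt_add_of_pos_right p hε2) (ε/2) hε2
    refine ⟨S, hS, T, hT, d.diamLE_mono h1 hhalf, d.diamLE_mono h2 hhalf, ?_⟩
    have heq : p + ε/2 + ε/2 = p + ε := by rw [add_assoc, hhalves]
    rwa [heq] at h3

theorem famLE_congr {F F' G G' : Set (Set X)} {q : ℚ≥0}
    (hF : d.IsCauchyFamily F) (hG : d.IsCauchyFamily G)
    (hFF' : d.famLE F F' 0) (hGG' : d.famLE G G' 0)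
    (h : d.famLE F G q) : d.famLE F' G' q := by
  have h1 : d.famLE F' G q := by
    have := d.famLE_triangle hF (d.famLE_symm hFF') h
    simpa using this
  have := d.famLE_triangle hG h1 hGG'
  simpa using this

/-- The type of Cauchy families on `X`. -/
def CauchyFam := {F : Set (Set X) // d.IsCauchyFamily F}

instance famSetoid : Setoid d.CauchyFam where
  r F G := d.famLE F.1 G.1 0
  iseqv := by
    refine ⟨fun F => d.famLE_self F.2 0, fun h => d.famLE_symm h, fun {F G H} h1 h2 => ?_⟩
    have := d.famLE_triangle G.2 h1 h2
    simpa using this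

/-- The completion `X̂`: the quotient of the Cauchy families by `d(F,F') ≤ 0`. -/
def Hat := Quotient d.famSetoid

/-- The premetric relation `d̂` on the quotient. -/
def hatLE (α β : d.Hat) (q : ℚ≥0) : Prop :=
  Quotient.liftOn₂ α β (fun F G => d.famLE F.1 G.1 q)
    (fun F G F' G' hF hG => propext
      ⟨fun h => d.famLE_congr F.2 G.2 hF hG h,
       fun h => d.famLE_congr F'.2 G'.2 (d.famLE_symm hF) (d.famLE_symm hG) h⟩)

/-- The premetric space `(X̂, d̂)`. -/
def hatPremetric : Premetric d.Hat where
  le := d.hatLE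
  refl_iff := fun α β => Quotient.inductionOn₂ α β fun F G =>
    ⟨fun h => Quotient.sound h, fun h => Quotient.exact h⟩
  symm := fun α β q => Quotient.inductionOn₂ α β fun F G h => d.famLE_symm h
  triangle := fun α β γ p q => Quotient.inductionOn₃ α β γ
    fun F G H h1 h2 => d.famLE_triangle H.2 h1 h2
  upper := fun α β p => Quotient.inductionOn₂ α β fun F G => d.famLE_upper p

/-- The natural map `i : X → X̂`, `x ↦ x*`, the class of the Cauchy family `{{x}}`. -/
def natMap (x : X) : d.Hat :=
  Quotient.mk d.famSetoid ⟨{({x} : Set X)}, d.isCauchyFamily_singleton x⟩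

/-- A regular family (Richman), presented as a function from positive rationals
(the value at `0` being irrelevant): `d(x,y) ≤ p + q` for `x ∈ S p`, `y ∈ S q`. -/
def IsRegularFamily (S : ℚ≥0 → Set X) : Prop :=
  ∀ p q : ℚ≥0, 0 < p → 0 < q → ∀ x ∈ S p, ∀ y ∈ S q, d.le x y (p + q)

/-- The type of regular families on `X`. -/
def RegularFam := {S : ℚ≥0 → Set X // d.IsRegularFamily S}

/-- Richman's equivalence of regular families. -/
def regEquiv (S T : d.RegularFam) : Prop :=
  ∀ p q : ℚ≥0, 0 < p → 0 < q → ∀ x ∈ S.1 p, ∀ y ∈ T.1 q, d.le x y (p + q)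

/-- Richman's completion `X̂_R`: the quotient of the regular families by equivalence. -/
def RHat := Quot d.regEquiv

/-- Richman's premetric between regular families:
`d̂_R(S,T) ≤ q` iff for all `ε > 0` there are `a,b,c > 0`, `s ∈ S a`, `t ∈ T b`
with `a+b+c < q+ε` and `d(s,t) ≤ c`. -/
def regLE (S T : ℚ≥0 → Set X) (q : ℚ≥0) : Prop :=
  ∀ ε : ℚ≥0, 0 < ε → ∃ a b c : ℚ≥0, 0 < a ∧ 0 < b ∧ 0 < c ∧
    ∃ s ∈ S a, ∃ t ∈ T b, a + b + c < q + ε ∧ d.le s t c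

/-- Richman's premetric `d̂_R` on the quotient `X̂_R`. -/
def rHatLE (α β : d.RHat) (q : ℚ≥0) : Prop :=
  ∃ S T : d.RegularFam, Quot.mk d.regEquiv S = α ∧ Quot.mk d.regEquiv T = β ∧
    d.regLE S.1 T.1 q

theorem isRegularFamily_const (x : X) :
    d.IsRegularFamily (fun _ => ({x} : Set X)) := by
  intro p q hp hq y hy z hz
  rw [Set.mem_singleton_iff] at hy hz
  rw [hy, hz]
  exact d.mono (d.refl x) zero_le

/-- The natural map `i_R : X → X̂_R`, sending `x` to the class of the constant
regular family `S_q = {x}`. -/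
def regNatMap (x : X) : d.RHat :=
  Quot.mk d.regEquiv ⟨fun _ => ({x} : Set X), d.isRegularFamily_const x⟩

end Premetric

/-- `f : X → Y` is an isometric embedding of premetric spaces. -/
def IsIsometricEmbedding {X Y : Type*} (dX : Premetric X) (dY : Premetric Y)
    (f : X → Y) : Prop :=
  ∀ (x x' : X) (q : ℚ≥0), dX.le x x' q ↔ dY.le (f x) (f x') q

/-- `f : X → Y` has dense image in the premetric space `Y`. -/
def HasDenseImage {X Y : Type*} (dY : Premetric Y) (f : X → Y) : Prop :=
  ∀ ε : ℚ≥0, 0 < ε → ∀ y : Y, ∃ x : X, dY.le (f x) y ε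

/-- The family `S^c = {S_q^c : q ∈ ℚ⁺}` with
`S_q^c = {f(x) : x ∈ A, d_C(h(x),c) ≤ q/2}`, used in the extension theorem. -/
def extFam {A B C : Type*} (dC : Premetric C) (f : A → B) (h : A → C) (c : C) :
    Set (Set B) :=
  {T | ∃ q : ℚ≥0, 0 < q ∧ T = {b | ∃ x : A, b = f x ∧ dC.le (h x) c (q / 2)}}

/-- For Cauchy families `F`, `F'` on a premetric space `(X,d)` and a
nonnegative rational `p`: `d(F,F') ≤ p` iff `d(F,F') ≤ q` for every `q > p`. -/
theorem statement6 (X : Type*) [Nonempty X] (d : Premetric X)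
    (F F' : Set (Set X)) (hF : d.IsCauchyFamily F) (hF' : d.IsCauchyFamily F')
    (p : ℚ≥0) :
    d.famLE F F' p ↔ ∀ q : ℚ≥0, p < q → d.famLE F F' q := by
  exact d.famLE_upper p
end

section
/- Let (X,d) be a premetric space. The relation d(F,F') ≤ q defined on the collection of Cauchy families on X is a pseudo-premetric: it satisfies d(F,F) ≤ 0 for every Cauchy family F, symmetry, the triangular inequality, and upper continuity. -/
/-- The relation `d(F,F') ≤ q` on the collection of Cauchy families
of a premetric space `(X,d)` is a pseudo-premetric: `d(F,F) ≤ 0`, symmetry, the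
triangular inequality and upper continuity hold. -/
theorem statement7 (X : Type*) [Nonempty X] (d : Premetric X) :
    ∃ D : PseudoPremetric d.CauchyFam,
      ∀ (F G : d.CauchyFam) (q : ℚ≥0), D.le F G q ↔ d.famLE F.1 G.1 q := by
  exact ⟨{
    le := fun F G q => d.famLE F.1 G.1 q
    refl := fun F => d.famLE_self F.2 0
    symm := fun _ _ _ h => d.famLE_symm h
    triangle := fun _ _ H _ _ h₁ h₂ => d.famLE_triangle H.2 h₁ h₂
    upper := fun _ _ p => d.famLE_upper p }, fun _ _ _ => Iff.rfl⟩
end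

section
/- Let (A,d_A), (B,d_B), (C,d_C) be premetric spaces, f : A → B an isometric embedding, and h : A → C an isometric embedding with dense image. Then there exists an isometric embedding g : C → B̂ such that g ∘ h = i ∘ f, where i : B → B̂ is the natural map. -/
section Extension

variable {A B C : Type*} {dA : Premetric A} {dB : Premetric B} {dC : Premetric C}
  {f : A → B} {h : A → C}

theorem IsIsometricEmbedding.le_iff_le (hf : IsIsometricEmbedding dA dB f)
    (hh : IsIsometricEmbedding dA dC h) (x y : A) (q : ℚ≥0) :
    dB.le (f x) (f y) q ↔ dC.le (h x) (h y) q :=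
  (hf x y q).symm.trans (hh x y q)

/-- The member of `extFam` with parameter `q` has diameter at most `q`. -/
theorem diamLE_extFam_member (hf : IsIsometricEmbedding dA dB f)
    (hh : IsIsometricEmbedding dA dC h) (c : C) (q : ℚ≥0) :
    dB.diamLE {b | ∃ x : A, b = f x ∧ dC.le (h x) c (q / 2)} q := by
  rintro _ ⟨x, rfl, hx⟩ _ ⟨y, rfl, hy⟩
  rw [hf.le_iff_le hh, ← add_halves q]
  exact dC.triangle _ _ _ _ _ hx (dC.symm _ _ _ hy)

theorem isCauchyFamily_extFam (hf : IsIsometricEmbedding dA dB f)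
    (hh : IsIsometricEmbedding dA dC h) (hdense : HasDenseImage dC h) (c : C) :
    dB.IsCauchyFamily (extFam dC f h c) := by
  refine ⟨?_, fun ε hε => ⟨_, ⟨ε, hε, rfl⟩, diamLE_extFam_member hf hh c ε⟩⟩
  rintro _ ⟨p, hp, rfl⟩ _ ⟨q, hq, rfl⟩
  obtain ⟨x, hx⟩ := hdense (min (p / 2) (q / 2)) (lt_min (half_pos hp) (half_pos hq)) c
  exact ⟨f x, ⟨x, rfl, dC.mono hx (min_le_left _ _)⟩, ⟨x, rfl, dC.mono hx (min_le_right _ _)⟩⟩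

theorem famLE_extFam_of_le (hf : IsIsometricEmbedding dA dB f)
    (hh : IsIsometricEmbedding dA dC h) {c c' : C} {q : ℚ≥0} (hc : dC.le c c' q) :
    dB.famLE (extFam dC f h c) (extFam dC f h c') q := by
  intro ε hε
  have hS := diamLE_extFam_member hf hh c ε
  have hT := diamLE_extFam_member hf hh c' ε
  have cross : ∀ x y, dC.le (h x) c (ε / 2) → dC.le (h y) c' (ε / 2) →
      dB.le (f x) (f y) (q + ε) := by
    intro x y hx hy
    rw [hf.le_iff_le hh]
    have hxy := dC.triangle _ _ _ _ _ (dC.triangle _ _ _ _ _ hx hc) (dC.symm _ _ _ hy)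
    rwa [add_comm (ε / 2) q, add_assoc, add_halves] at hxy
  refine ⟨_, ⟨ε, hε, rfl⟩, _, ⟨ε, hε, rfl⟩, hS, hT, ?_⟩
  rintro u (hu | hu) v (hv | hv)
  · exact dB.mono (hS u hu v hv) le_add_self
  · obtain ⟨x, rfl, hx⟩ := hu
    obtain ⟨y, rfl, hy⟩ := hv
    exact cross x y hx hy
  · obtain ⟨x, rfl, hx⟩ := hu
    obtain ⟨y, rfl, hy⟩ := hv
    exact dB.symm _ _ _ (cross y x hy hx)
  · exact dB.mono (hT u hu v hv) le_add_self

theorem le_of_famLE_extFam (hf : IsIsometricEmbedding dA dB f)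
    (hh : IsIsometricEmbedding dA dC h) (hdense : HasDenseImage dC h) {c c' : C} {q : ℚ≥0}
    (hc : dB.famLE (extFam dC f h c) (extFam dC f h c') q) : dC.le c c' q := by
  rw [dC.upper]
  intro r hqr
  obtain ⟨δ, hδ, rfl⟩ := exists_pos_add_of_lt' hqr
  have hε : 0 < δ / 3 := div_pos hδ (by norm_num)
  obtain ⟨_, ⟨s, hs, rfl⟩, _, ⟨t, ht, rfl⟩, -, -, hST⟩ := hc (δ / 3) hε
  obtain ⟨x, hx⟩ := hdense (min (s / 2) (δ / 3)) (lt_min (half_pos hs) hε) c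
  obtain ⟨y, hy⟩ := hdense (min (t / 2) (δ / 3)) (lt_min (half_pos ht) hε) c'
  have hxy := hST (f x) (Or.inl ⟨x, rfl, dC.mono hx (min_le_left _ _)⟩)
    (f y) (Or.inr ⟨y, rfl, dC.mono hy (min_le_left _ _)⟩)
  rw [hf.le_iff_le hh] at hxy
  have hcc' := dC.triangle _ _ _ _ _ (dC.triangle _ _ _ _ _
    (dC.symm _ _ _ (dC.mono hx (min_le_right _ _))) hxy) (dC.mono hy (min_le_right _ _))
  have heq : δ / 3 + (q + δ / 3) + δ / 3 = q + δ := by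
    field_simp
    ring
  rwa [heq] at hcc'

theorem famLE_extFam_singleton (hf : IsIsometricEmbedding dA dB f)
    (hh : IsIsometricEmbedding dA dC h) (a : A) :
    dB.famLE (extFam dC f h (h a)) {{f a}} 0 := by
  intro ε hε
  have hS := diamLE_extFam_member hf hh (h a) ε
  have ha : f a ∈ {b | ∃ x : A, b = f x ∧ dC.le (h x) (h a) (ε / 2)} :=
    ⟨a, rfl, dC.mono (dC.refl _) zero_le⟩
  have hsub := Set.singleton_subset_iff.2 ha
  refine ⟨_, ⟨ε, hε, rfl⟩, _, rfl, hS, fun u hu v hv => hS u (hsub hu) v (hsub hv), ?_⟩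
  rwa [Set.union_eq_self_of_subset_right hsub, zero_add]

end Extension

/-- Extension theorem. Given premetric spaces `A`, `B`, `C`, an
isometric embedding `f : A → B` and an isometric embedding `h : A → C` with
dense image, there is an isometric embedding `g : C → B̂` with `g ∘ h = i ∘ f`,
`i : B → B̂` the natural map. -/
theorem statement10 {A B C : Type*} [Nonempty A] [Nonempty B] [Nonempty C]
    (dA : Premetric A) (dB : Premetric B) (dC : Premetric C)
    (f : A → B) (hf : IsIsometricEmbedding dA dB f)
    (h : A → C) (hh : IsIsometricEmbedding dA dC h)
    (hdense : HasDenseImage dC h) :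
    ∃ g : C → dB.Hat, IsIsometricEmbedding dC dB.hatPremetric g ∧
      g ∘ h = dB.natMap ∘ f := by
  refine ⟨fun c => Quotient.mk dB.famSetoid
    ⟨extFam dC f h c, isCauchyFamily_extFam hf hh hdense c⟩, fun c c' q => ?_, ?_⟩
  · exact ⟨famLE_extFam_of_le hf hh, le_of_famLE_extFam hf hh hdense⟩
  · funext a
    exact Quotient.sound (famLE_extFam_singleton hf hh a)
end

section
/- Let (A,d_A), (B,d_B), (C,d_C) be premetric spaces, f : A → B an isometric embedding, and h : A → C an isometric embedding with dense image. For each c ∈ C and positive rational q let S_q^c = {f(x) : x ∈ A, d_C(h(x),c) ≤ q/2}. Then for every c ∈ C the collection S^c = {S_q^c : q ∈ ℚ⁺} is a Cauchy family on B. -/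
/-- With `f : A → B` an isometric embedding and `h : A → C` an
isometric embedding with dense image, for every `c ∈ C` the collection
`S^c = {S_q^c : q ∈ ℚ⁺}`, where `S_q^c = {f(x) : x ∈ A, d_C(h(x),c) ≤ q/2}`, is
a Cauchy family on `B`. -/
theorem statement12 {A B C : Type*} [Nonempty A] [Nonempty B] [Nonempty C]
    (dA : Premetric A) (dB : Premetric B) (dC : Premetric C)
    (f : A → B) (hf : IsIsometricEmbedding dA dB f)
    (h : A → C) (hh : IsIsometricEmbedding dA dC h)
    (hdense : HasDenseImage dC h) (c : C) :
    dB.IsCauchyFamily (extFam dC f h c) := by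
  constructor
  · rintro _ ⟨p, hp, rfl⟩ _ ⟨q, hq, rfl⟩
    obtain ⟨x, hx⟩ := hdense (min (p / 2) (q / 2)) (lt_min (half_pos hp) (half_pos hq)) c
    exact ⟨f x, ⟨x, rfl, dC.mono hx (min_le_left _ _)⟩, ⟨x, rfl, dC.mono hx (min_le_right _ _)⟩⟩
  · intro ε hε
    refine ⟨_, ⟨ε, hε, rfl⟩, ?_⟩
    rintro _ ⟨x, rfl, hx⟩ _ ⟨y, rfl, hy⟩
    rw [← hf, hh, ← add_halves ε]
    exact dC.triangle _ _ c _ _ hx (dC.symm _ _ _ hy)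
end

section
/- Let (X,d) be a premetric space. Then (X̂, d̂) is a complete premetric space, i.e., the natural map j : X̂ → (X̂)̂ is onto. -/
namespace Premetric

variable {X : Type*} (d : Premetric X)

theorem famLE_singleton_of_mem {F : Set (Set X)} (hF : d.IsCauchyFamily F) {S : Set X}
    (hS : S ∈ F) {r : ℚ≥0} (hr : d.diamLE S r) {x : X} (hx : x ∈ S) :
    d.famLE {({x} : Set X)} F r := by
  intro ε hε
  obtain ⟨T, hT, hdT⟩ := hF.2 ε hε
  obtain ⟨t, htS, htT⟩ := hF.1 S hS T hT
  have key : ∀ y ∈ T, d.le x y (r + ε) := fun y hy =>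
    d.triangle x y t _ _ (hr x hx t htS) (hdT t htT y hy)
  refine ⟨{x}, rfl, T, hT, ?_, hdT, ?_⟩
  · rintro a rfl b rfl
    exact d.mono (d.refl _) zero_le
  · rintro a (rfl | ha) b (rfl | hb)
    · exact d.mono (d.refl _) zero_le
    · exact key b hb
    · exact d.symm _ _ _ (key a ha)
    · exact d.mono (hdT a ha b hb) (le_add_of_nonneg_left zero_le)

theorem exists_natMap_hatLE (α : d.Hat) {δ : ℚ≥0} (hδ : 0 < δ) :
    ∃ x : X, d.hatPremetric.le (d.natMap x) α δ := by
  induction α using Quotient.inductionOn with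
  | h G =>
    obtain ⟨S, hS, hdS⟩ := G.2.2 δ hδ
    obtain ⟨x, hx, -⟩ := G.2.1 S hS S hS
    exact ⟨x, d.famLE_singleton_of_mem G.2 hS hdS hx⟩

theorem le_of_hatLE_natMap {x y : X} {q : ℚ≥0}
    (h : d.hatPremetric.le (d.natMap x) (d.natMap y) q) : d.le x y q := by
  refine (d.upper x y q).2 fun p hp => ?_
  obtain ⟨S, rfl, T, rfl, -, -, hST⟩ := h (p - q) (tsub_pos_of_lt hp)
  rw [add_tsub_cancel_of_le hp.le] at hST
  exact hST x (Or.inl rfl) y (Or.inr rfl)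

/-- The points of `X` whose image in `X̂` lies within `δ` of some element of `A`. -/
def hatThickening (A : Set d.Hat) (δ : ℚ≥0) : Set X :=
  {x | ∃ α ∈ A, d.hatPremetric.le (d.natMap x) α δ}

theorem diamLE_hatThickening {A : Set d.Hat} {δ : ℚ≥0} (hA : d.hatPremetric.diamLE A δ) :
    d.diamLE (d.hatThickening A δ) (δ + δ + δ) := by
  rintro x ⟨α, hα, hxα⟩ y ⟨β, hβ, hyβ⟩
  exact d.le_of_hatLE_natMap <| d.hatPremetric.triangle _ _ β _ _
    (d.hatPremetric.triangle _ _ α _ _ hxα (hA α hα β hβ)) (d.hatPremetric.symm _ _ _ hyβ)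

/-- The family on `X` of thickened small members of a family on `X̂`. -/
def hatTrace (Φ : Set (Set d.Hat)) : Set (Set X) :=
  {S | ∃ A ∈ Φ, ∃ δ : ℚ≥0, 0 < δ ∧ d.hatPremetric.diamLE A δ ∧ S = d.hatThickening A δ}

theorem isCauchyFamily_hatTrace {Φ : Set (Set d.Hat)}
    (hΦ : d.hatPremetric.IsCauchyFamily Φ) : d.IsCauchyFamily (d.hatTrace Φ) := by
  constructor
  · rintro _ ⟨A, hA, δ, hδ, -, rfl⟩ _ ⟨B, hB, η, hη, -, rfl⟩
    obtain ⟨γ, hγA, hγB⟩ := hΦ.1 A hA B hB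
    obtain ⟨x, hx⟩ := d.exists_natMap_hatLE γ (lt_min hδ hη)
    exact ⟨x, ⟨γ, hγA, d.hatPremetric.mono hx (min_le_left _ _)⟩,
      ⟨γ, hγB, d.hatPremetric.mono hx (min_le_right _ _)⟩⟩
  · intro ε hε
    have hδ : 0 < ε / 3 := by positivity
    obtain ⟨A, hA, hdA⟩ := hΦ.2 (ε / 3) hδ
    refine ⟨_, ⟨A, hA, ε / 3, hδ, hdA, rfl⟩, d.diamLE_mono (d.diamLE_hatThickening hdA) ?_⟩
    exact le_of_eq (by ring)

theorem hatLE_mk_hatTrace {Φ : Set (Set d.Hat)} (hΦ : d.hatPremetric.IsCauchyFamily Φ)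
    {A : Set d.Hat} (hA : A ∈ Φ) {δ : ℚ≥0} (hδ : 0 < δ) (hdA : d.hatPremetric.diamLE A δ)
    {α : d.Hat} (hα : α ∈ A) :
    d.hatPremetric.le α (Quotient.mk d.famSetoid ⟨d.hatTrace Φ, d.isCauchyFamily_hatTrace hΦ⟩)
      (δ + (δ + δ + δ)) := by
  obtain ⟨x, hx⟩ := d.exists_natMap_hatLE α hδ
  exact d.hatPremetric.triangle _ _ (d.natMap x) _ _ (d.hatPremetric.symm _ _ _ hx)
    (d.famLE_singleton_of_mem (d.isCauchyFamily_hatTrace hΦ) ⟨A, hA, δ, hδ, hdA, rfl⟩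
      (d.diamLE_hatThickening hdA) ⟨α, hα, hx⟩)

end Premetric

/-- `(X̂, d̂)` is a complete premetric space: the natural map
`j : X̂ → (X̂)̂` is onto. -/
theorem statement14 (X : Type*) [Nonempty X] (d : Premetric X) :
    Function.Surjective d.hatPremetric.natMap := by
  intro ξ
  induction ξ using Quotient.inductionOn with
  | h Φ =>
    obtain ⟨Φ, hΦ⟩ := Φ
    refine ⟨Quotient.mk d.famSetoid ⟨d.hatTrace Φ, d.isCauchyFamily_hatTrace hΦ⟩,
      Quotient.sound ?_⟩
    intro ε hε
    have hδ : 0 < ε / 4 := by positivity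
    obtain ⟨A, hA, hdA⟩ := hΦ.2 (ε / 4) hδ
    have hsum : ε / 4 + (ε / 4 + ε / 4 + ε / 4) = ε := by ring
    have hdAε : d.hatPremetric.diamLE A ε :=
      d.hatPremetric.diamLE_mono hdA (by
        calc ε / 4 ≤ ε / 4 + (ε / 4 + ε / 4 + ε / 4) := le_add_of_nonneg_right zero_le
          _ = ε := hsum)
    have key : ∀ α ∈ A, d.hatPremetric.le α _ ε := fun α hα =>
      hsum ▸ d.hatLE_mk_hatTrace hΦ hA hδ hdA hα
    refine ⟨_, rfl, A, hA, ?_, hdAε, ?_⟩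
    · rintro a rfl b rfl
      exact d.hatPremetric.mono (d.hatPremetric.refl _) zero_le
    · rw [zero_add]
      rintro a (rfl | ha) b (rfl | hb)
      · exact d.hatPremetric.mono (d.hatPremetric.refl _) zero_le
      · exact d.hatPremetric.symm _ _ _ (key b hb)
      · exact key a ha
      · exact hdAε a ha b hb
end

section
/- Let (X,d) be a premetric space, (Y,d_Y) a complete premetric space, and h : X → Y an isometric embedding with dense image. Then there exists an isometry u : Y → X̂ such that u ∘ h = i, where i : X → X̂ is the natural map. In particular, the completion of a premetric space is unique up to isometry. -/
namespace Premetric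

variable {X Y : Type*} {d : Premetric X} {dY : Premetric Y} {h : X → Y}

/-- The images under `h` of the members of `F` are eventually close to `y`. -/
def ConvergesAlong (dY : Premetric Y) (h : X → Y) (F : Set (Set X)) (y : Y) : Prop :=
  ∀ ε : ℚ≥0, 0 < ε → ∃ S ∈ F, ∀ x ∈ S, dY.le (h x) y ε

theorem le_of_forall_pos {y z : Y} {q : ℚ≥0}
    (H : ∀ ε : ℚ≥0, 0 < ε → dY.le y z (q + ε)) : dY.le y z q := by
  refine (dY.upper y z q).2 fun p hp => ?_
  simpa [add_tsub_cancel_of_le hp.le] using H (p - q) (tsub_pos_of_lt hp)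

theorem ConvergesAlong.famLE_iff (hh : IsIsometricEmbedding d dY h) {F G : Set (Set X)}
    (hF : d.IsCauchyFamily F) (hG : d.IsCauchyFamily G) {y z : Y}
    (hFy : ConvergesAlong dY h F y) (hGz : ConvergesAlong dY h G z) (q : ℚ≥0) :
    d.famLE F G q ↔ dY.le y z q := by
  constructor
  · intro H
    refine le_of_forall_pos fun ε hε => ?_
    have hε3 : 0 < ε / 3 := by positivity
    obtain ⟨S, hS, T, hT, -, -, hST⟩ := H (ε / 3) hε3
    obtain ⟨S', hS', hSy⟩ := hFy (ε / 3) hε3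
    obtain ⟨T', hT', hTz⟩ := hGz (ε / 3) hε3
    obtain ⟨s, hs, hs'⟩ := hF.1 S hS S' hS'
    obtain ⟨t, ht, ht'⟩ := hG.1 T hT T' hT'
    have hst := (hh s t _).1 (hST s (Or.inl hs) t (Or.inr ht))
    have hyt := dY.triangle _ _ _ _ _ (dY.symm _ _ _ (hSy s hs')) hst
    have hyz := dY.triangle _ _ _ _ _ hyt (hTz t ht')
    have hsum : ε / 3 + (q + ε / 3) + ε / 3 = q + ε := by ring
    rwa [hsum] at hyz
  · intro H ε hε
    have hε2 : 0 < ε / 2 := by positivity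
    obtain ⟨S, hS, hSy⟩ := hFy (ε / 2) hε2
    obtain ⟨T, hT, hTz⟩ := hGz (ε / 2) hε2
    have hdiam : ∀ {w : Y} {R : Set X}, (∀ x ∈ R, dY.le (h x) w (ε / 2)) → d.diamLE R ε := by
      intro w R hR a ha b hb
      have hab := dY.triangle _ _ _ _ _ (hR a ha) (dY.symm _ _ _ (hR b hb))
      rw [add_halves] at hab
      exact (hh a b ε).2 hab
    have hcross : ∀ s ∈ S, ∀ t ∈ T, d.le s t (q + ε) := by
      intro s hs t ht
      have hsz := dY.triangle _ _ _ _ _ (hSy s hs) H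
      have hst := dY.triangle _ _ _ _ _ hsz (dY.symm _ _ _ (hTz t ht))
      have hsum : ε / 2 + q + ε / 2 = q + ε := by ring
      rw [hsum] at hst
      exact (hh s t _).2 hst
    refine ⟨S, hS, T, hT, hdiam hSy, hdiam hTz, ?_⟩
    rintro a (ha | ha) b (hb | hb)
    · exact d.mono (hdiam hSy a ha b hb) le_add_self
    · exact hcross a ha b hb
    · exact d.symm _ _ _ (hcross b hb a ha)
    · exact d.mono (hdiam hTz a ha b hb) le_add_self

theorem exists_cauchyFam_convergesAlong (hh : IsIsometricEmbedding d dY h)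
    (hdense : HasDenseImage dY h) (y : Y) :
    ∃ F : d.CauchyFam, ConvergesAlong dY h F.1 y := by
  refine ⟨⟨{S | ∃ q : ℚ≥0, 0 < q ∧ S = {x | dY.le (h x) y q}}, ?_, ?_⟩, ?_⟩
  · rintro _ ⟨p, hp, rfl⟩ _ ⟨q, hq, rfl⟩
    obtain ⟨x, hx⟩ := hdense (min p q) (lt_min hp hq) y
    exact ⟨x, dY.mono hx (min_le_left _ _), dY.mono hx (min_le_right _ _)⟩
  · intro ε hε
    refine ⟨_, ⟨ε / 2, by positivity, rfl⟩, fun a ha b hb => (hh a b ε).2 ?_⟩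
    have hab := dY.triangle _ _ _ _ _ ha (dY.symm _ _ _ hb)
    rwa [add_halves] at hab
  · intro ε hε
    exact ⟨_, ⟨ε, hε, rfl⟩, fun _ hx => hx⟩

theorem IsCauchyFamily.image (hh : IsIsometricEmbedding d dY h) {F : Set (Set X)}
    (hF : d.IsCauchyFamily F) : dY.IsCauchyFamily (Set.image h '' F) := by
  constructor
  · rintro _ ⟨S, hS, rfl⟩ _ ⟨T, hT, rfl⟩
    obtain ⟨x, hxS, hxT⟩ := hF.1 S hS T hT
    exact ⟨h x, Set.mem_image_of_mem h hxS, Set.mem_image_of_mem h hxT⟩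
  · intro ε hε
    obtain ⟨S, hS, hdiam⟩ := hF.2 ε hε
    refine ⟨_, Set.mem_image_of_mem _ hS, ?_⟩
    rintro _ ⟨a, ha, rfl⟩ _ ⟨b, hb, rfl⟩
    exact (hh a b ε).1 (hdiam a ha b hb)

theorem IsCauchyFamily.exists_convergesAlong (hY : Function.Surjective dY.natMap)
    (hh : IsIsometricEmbedding d dY h) {F : Set (Set X)} (hF : d.IsCauchyFamily F) :
    ∃ y, ConvergesAlong dY h F y := by
  obtain ⟨y, hy⟩ := hY (Quotient.mk dY.famSetoid ⟨_, hF.image hh⟩)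
  have hfam : dY.famLE {({y} : Set Y)} (Set.image h '' F) 0 := Quotient.exact hy
  refine ⟨y, fun ε hε => ?_⟩
  obtain ⟨_, rfl, _, ⟨S, hS, rfl⟩, -, -, hdiam⟩ := hfam ε hε
  rw [zero_add] at hdiam
  exact ⟨S, hS, fun x hx => hdiam _ (Or.inr (Set.mem_image_of_mem h hx)) _ (Or.inl rfl)⟩

theorem convergesAlong_singleton (x : X) : ConvergesAlong dY h {({x} : Set X)} (h x) := by
  rintro ε -
  refine ⟨_, rfl, ?_⟩
  rintro _ rfl
  exact dY.mono (dY.refl _) zero_le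

end Premetric

/-- If `Y` is a complete premetric space and `h : X → Y` is an
isometric embedding with dense image, then there is an isometry `u : Y → X̂`
with `u ∘ h = i`; in particular the completion is unique up to isometry. -/
theorem statement15 (X Y : Type*) [Nonempty X] [Nonempty Y]
    (d : Premetric X) (dY : Premetric Y)
    (hYcomplete : Function.Surjective dY.natMap)
    (h : X → Y) (hh : IsIsometricEmbedding d dY h)
    (hdense : HasDenseImage dY h) :
    ∃ u : Y → d.Hat, IsIsometricEmbedding dY d.hatPremetric u ∧
      Function.Surjective u ∧ u ∘ h = d.natMap := by
  choose F hF using Premetric.exists_cauchyFam_convergesAlong hh hdense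
  have hmk : ∀ (G : d.CauchyFam) (y : Y), Premetric.ConvergesAlong dY h G.1 y →
      Quotient.mk d.famSetoid (F y) = Quotient.mk d.famSetoid G := fun G y hG =>
    Quotient.sound (((hF y).famLE_iff hh (F y).2 G.2 hG 0).2 (dY.refl y))
  refine ⟨fun y => Quotient.mk d.famSetoid (F y), fun y z q => ?_, fun α => ?_, ?_⟩
  · exact ((hF y).famLE_iff hh (F y).2 (F z).2 (hF z) q).symm
  · induction α using Quotient.inductionOn with
    | h G =>
      obtain ⟨y, hy⟩ := G.2.exists_convergesAlong hYcomplete hh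
      exact ⟨y, hmk G y hy⟩
  · funext x
    exact hmk _ _ (Premetric.convergesAlong_singleton x)
end

section
/- Let (X,d) be a premetric space and s ∈ X̂. For each positive rational q let S_q = {x ∈ X : d̂(i(x), s) ≤ q}, where i : X → X̂ is the natural map. Then the family S = {S_q : q ∈ ℚ⁺} is both a regular family and a Cauchy family on X. -/
namespace Premetric

theorem le_of_hatPremetric_le_natMap {X : Type*} (d : Premetric X) {x y : X} {q : ℚ≥0}
    (h : d.hatPremetric.le (d.natMap x) (d.natMap y) q) : d.le x y q := by
  refine (d.upper x y q).2 fun r hr => ?_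
  obtain ⟨S, rfl, T, rfl, -, -, hST⟩ := h (r - q) (tsub_pos_of_lt hr)
  simpa [add_tsub_cancel_of_le hr.le] using hST x (Or.inl rfl) y (Or.inr rfl)

theorem famLE_singleton_of_mem_s19 {X : Type*} (d : Premetric X) {F : Set (Set X)}
    (hF : d.IsCauchyFamily F) {T : Set X} (hT : T ∈ F) {q : ℚ≥0} (hTq : d.diamLE T q)
    {x : X} (hx : x ∈ T) : d.famLE {({x} : Set X)} F q := by
  intro ε hε
  obtain ⟨U, hU, hUε⟩ := hF.2 ε hε
  obtain ⟨t, htT, htU⟩ := hF.1 T hT U hU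
  have key : ∀ y ∈ U, d.le x y (q + ε) := fun y hy =>
    d.triangle x y t q ε (hTq x hx t htT) (hUε t htU y hy)
  refine ⟨{x}, rfl, U, hU, ?_, hUε, ?_⟩
  · rintro _ rfl _ rfl
    exact d.mono (d.refl _) zero_le
  · rintro a (rfl | ha) b (rfl | hb)
    · exact d.mono (d.refl _) zero_le
    · exact key b hb
    · exact d.symm _ _ _ (key a ha)
    · exact d.mono (hUε a ha b hb) le_add_self

theorem hasDenseImage_natMap {X : Type*} (d : Premetric X) :
    HasDenseImage d.hatPremetric d.natMap := by
  intro ε hε s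
  induction s using Quotient.inductionOn with
  | h F =>
    obtain ⟨T, hT, hTε⟩ := F.2.2 ε hε
    obtain ⟨x, hx, -⟩ := F.2.1 T hT T hT
    exact ⟨x, d.famLE_singleton_of_mem_s19 F.2 hT hTε hx⟩

theorem isRegularFamily_hatBall {X : Type*} (d : Premetric X) (s : d.Hat) :
    d.IsRegularFamily (fun q => {x : X | d.hatPremetric.le (d.natMap x) s q}) :=
  fun p q _ _ _ hx _ hy => d.le_of_hatPremetric_le_natMap
    (d.hatPremetric.triangle _ _ s p q hx (d.hatPremetric.symm _ _ _ hy))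

end Premetric

/-- For `s ∈ X̂` and `S_q = {x ∈ X : d̂(i(x), s) ≤ q}`, the family
`S = {S_q : q ∈ ℚ⁺}` is both a regular family and a Cauchy family on `X`. -/
theorem statement19 (X : Type*) [Nonempty X] (d : Premetric X) (s : d.Hat) :
    d.IsRegularFamily (fun q => {x : X | d.hatPremetric.le (d.natMap x) s q}) ∧
    d.IsCauchyFamily
      {A : Set X | ∃ q : ℚ≥0, 0 < q ∧
        A = {x : X | d.hatPremetric.le (d.natMap x) s q}} := by
  refine ⟨d.isRegularFamily_hatBall s, ?_, fun ε hε => ?_⟩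
  · rintro _ ⟨p, hp, rfl⟩ _ ⟨q, hq, rfl⟩
    obtain ⟨x, hx⟩ := d.hasDenseImage_natMap (min p q) (lt_min hp hq) s
    exact ⟨x, d.hatPremetric.mono hx (min_le_left p q),
      d.hatPremetric.mono hx (min_le_right p q)⟩
  · have hε2 : 0 < ε / 2 := half_pos hε
    refine ⟨_, ⟨ε / 2, hε2, rfl⟩, fun x hx y hy => ?_⟩
    simpa only [add_halves] using
      d.isRegularFamily_hatBall s (ε / 2) (ε / 2) hε2 hε2 x hx y hy
end
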